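/- Deterministic ℓ1 estimation bound for the sg-LASSO (Remark 1, deterministic form). Under the same hypotheses as the deterministic estimation oracle inequality — y = m + u, λ > 0, c > 1, c₀ = (c+1)/(c−1), β ≠ 0 with support S₀ and group support 𝒢₀, β̂ a minimizer of ‖y − Xb‖_T² + 2λΩ(b), dual bound |⟨u, Xb⟩|/T ≤ (λ/c)Ω(b) for all b, restricted eigenvalue Δᵀ Σ Δ ≥ γ ∑_{G∈𝒢₀}|Δ_G|₂² for all Δ ∈ 𝒞(2c₀), and every entry of XᵀX/T − Σ at most γ/(2 G* s_α (1+2c₀)²) in absolute value — the ℓ1 estimation error satisfies |β̂ − β|₁ ≤ √(G*) · [ √( 2(1+2c₀)² (C₁ s_α λ² + 4‖m − Xβ‖_T²) s_α / γ ) + (1 + 1/(2c₀)) · (4c / ((c−1)λ)) · ‖m − Xβ‖_T² ], where C₁ = 4A(1+c₀)²(1 + 1/c)²/γ and A = 2(1+2c₀)²/(2(1+2c₀)² − (1+c₀)²). -/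

import Mathlib

open Finset

noncomputable section

open scoped Classical

/-- ℓ1 norm on ℝ^p. -/
def l1 {p : ℕ} (b : Fin p → ℝ) : ℝ := ∑ i, |b i|

/-- ℓ2 norm on ℝ^p. -/
def l2 {p : ℕ} (b : Fin p → ℝ) : ℝ := Real.sqrt (∑ i, (b i) ^ 2)

/-- `restr b S` keeps the coordinates of `b` on `S` and puts zeros elsewhere. -/
def restr {p : ℕ} (b : Fin p → ℝ) (S : Finset (Fin p)) : Fin p → ℝ :=
  fun i => if i ∈ S then b i else 0

/-- `G` is a partition of `{1,…,p}` into nonempty pairwise disjoint groups. -/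
def IsPartition {p : ℕ} (G : Finset (Finset (Fin p))) : Prop :=
  (∀ g ∈ G, g.Nonempty) ∧ (∀ g ∈ G, ∀ g' ∈ G, g ≠ g' → Disjoint g g') ∧
    (∀ i : Fin p, ∃ g ∈ G, i ∈ g)

/-- The sg-LASSO penalty `Ω(b) = α|b|₁ + (1−α)∑_{G∈𝒢}|b_G|₂`. -/
def sgl {p : ℕ} (α : ℝ) (G : Finset (Finset (Fin p))) (b : Fin p → ℝ) : ℝ :=
  α * l1 b + (1 - α) * ∑ g ∈ G, l2 (restr b g)

/-- Support `S₀ = {j : β_j ≠ 0}` of `β`. -/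
def supp {p : ℕ} (β : Fin p → ℝ) : Finset (Fin p) :=
  Finset.univ.filter (fun j => β j ≠ 0)

/-- Group support `𝒢₀ = {G ∈ 𝒢 : β_G ≠ 0}` of `β`. -/
def gsupp {p : ℕ} (G : Finset (Finset (Fin p))) (β : Fin p → ℝ) :
    Finset (Finset (Fin p)) :=
  G.filter (fun g => restr β g ≠ 0)

/-- `Ω₀(b) = α|b_{S₀}|₁ + (1−α)∑_{G∈𝒢₀}|b_G|₂`. -/
def sgl0 {p : ℕ} (α : ℝ) (G : Finset (Finset (Fin p))) (β b : Fin p → ℝ) : ℝ :=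
  α * l1 (restr b (supp β)) + (1 - α) * ∑ g ∈ gsupp G β, l2 (restr b g)

/-- `Ω₁(b) = α|b_{S₀ᶜ}|₁ + (1−α)∑_{G∈𝒢∖𝒢₀}|b_G|₂`. -/
def sgl1 {p : ℕ} (α : ℝ) (G : Finset (Finset (Fin p))) (β b : Fin p → ℝ) : ℝ :=
  α * l1 (restr b (supp β)ᶜ) + (1 - α) * ∑ g ∈ G \ gsupp G β, l2 (restr b g)

/-- Effective sparsity constant `s_α`, defined via
`√(s_α) = α√|S₀| + (1−α)√|𝒢₀|`. -/
def salpha {p : ℕ} (α : ℝ) (G : Finset (Finset (Fin p))) (β : Fin p → ℝ) : ℝ :=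
  (α * Real.sqrt ((supp β).card) + (1 - α) * Real.sqrt ((gsupp G β).card)) ^ 2

/-- Empirical squared norm `‖v‖_T² = |v|₂²/T`. -/
def normT2 {T : ℕ} (v : Fin T → ℝ) : ℝ := (∑ t, (v t) ^ 2) / T

/-- Empirical norm `‖v‖_T = √(|v|₂²/T)`. -/
def normT {T : ℕ} (v : Fin T → ℝ) : ℝ := Real.sqrt ((∑ t, (v t) ^ 2) / T)

lemma l2_eq_norm {p : ℕ} (b : Fin p → ℝ) : l2 b = ‖WithLp.toLp 2 b‖ := by
  simp [l2, EuclideanSpace.norm_eq]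

lemma l2_nonneg {p : ℕ} (b : Fin p → ℝ) : 0 ≤ l2 b := Real.sqrt_nonneg _

lemma l2_add_le {p : ℕ} (a b : Fin p → ℝ) : l2 (a + b) ≤ l2 a + l2 b := by
  simp only [l2_eq_norm, WithLp.toLp_add]
  exact norm_add_le _ _

lemma l2_smul {p : ℕ} (t : ℝ) (ht : 0 ≤ t) (b : Fin p → ℝ) : l2 (t • b) = t * l2 b := by
  simp only [l2_eq_norm, WithLp.toLp_smul, norm_smul, Real.norm_eq_abs, abs_of_nonneg ht]

lemma l1_nonneg {p : ℕ} (b : Fin p → ℝ) : 0 ≤ l1 b :=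
  Finset.sum_nonneg fun _ _ => abs_nonneg _

lemma l1_add_le {p : ℕ} (a b : Fin p → ℝ) : l1 (a + b) ≤ l1 a + l1 b := by
  unfold l1
  rw [← Finset.sum_add_distrib]
  exact Finset.sum_le_sum fun i _ => abs_add_le _ _

lemma l1_smul {p : ℕ} (t : ℝ) (ht : 0 ≤ t) (b : Fin p → ℝ) : l1 (t • b) = t * l1 b := by
  simp [l1, abs_mul, abs_of_nonneg ht, Finset.mul_sum]

lemma restr_add {p : ℕ} (a b : Fin p → ℝ) (S : Finset (Fin p)) :
    restr (a + b) S = restr a S + restr b S := by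
  ext i; by_cases h : i ∈ S <;> simp [restr, h]

lemma restr_smul {p : ℕ} (t : ℝ) (b : Fin p → ℝ) (S : Finset (Fin p)) :
    restr (t • b) S = t • restr b S := by
  ext i; by_cases h : i ∈ S <;> simp [restr, h]

lemma sgl_add_le {p : ℕ} (α : ℝ) (h0 : 0 ≤ α) (h1 : α ≤ 1) (G : Finset (Finset (Fin p)))
    (a b : Fin p → ℝ) : sgl α G (a + b) ≤ sgl α G a + sgl α G b := by
  have e1 := mul_le_mul_of_nonneg_left (l1_add_le a b) h0
  have e2 : ∑ g ∈ G, l2 (restr (a + b) g) ≤ ∑ g ∈ G, l2 (restr a g) + ∑ g ∈ G, l2 (restr b g) := by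
    rw [← Finset.sum_add_distrib]
    refine Finset.sum_le_sum fun g _ => ?_
    rw [restr_add]; exact l2_add_le _ _
  have e3 := mul_le_mul_of_nonneg_left e2 (sub_nonneg.2 h1)
  unfold sgl; linarith

lemma sgl_smul {p : ℕ} (α : ℝ) (G : Finset (Finset (Fin p))) (t : ℝ) (ht : 0 ≤ t)
    (b : Fin p → ℝ) : sgl α G (t • b) = t * sgl α G b := by
  have e : ∑ g ∈ G, l2 (restr (t • b) g) = t * ∑ g ∈ G, l2 (restr b g) := by
    rw [Finset.mul_sum]
    refine Finset.sum_congr rfl fun g _ => ?_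
    rw [restr_smul, l2_smul t ht]
  unfold sgl; rw [e, l1_smul t ht]; ring

lemma l1_split {p : ℕ} (b : Fin p → ℝ) (S : Finset (Fin p)) :
    l1 b = l1 (restr b S) + l1 (restr b Sᶜ) := by
  unfold l1
  rw [← Finset.sum_add_distrib]
  refine Finset.sum_congr rfl fun i _ => ?_
  by_cases h : i ∈ S <;> simp [restr, h]

lemma sgl_split {p : ℕ} (α : ℝ) (G : Finset (Finset (Fin p))) (β b : Fin p → ℝ) :
    sgl α G b = sgl0 α G β b + sgl1 α G β b := by
  have e := Finset.sum_sdiff (f := fun g => l2 (restr b g))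
    (Finset.filter_subset (fun g => restr β g ≠ 0) G)
  have e1 := l1_split b (supp β)
  unfold sgl sgl0 sgl1 gsupp
  rw [← e, e1]; ring

lemma sgl_diff {p : ℕ} (α : ℝ) (h0 : 0 ≤ α) (h1 : α ≤ 1) (G : Finset (Finset (Fin p)))
    (β b : Fin p → ℝ) :
    sgl α G β - sgl α G b ≤ sgl0 α G β (b - β) - sgl1 α G β (b - β) := by
  have e1 : l1 β - l1 b ≤ l1 (restr (b - β) (supp β)) - l1 (restr (b - β) (supp β)ᶜ) := by
    unfold l1
    rw [← Finset.sum_sub_distrib, ← Finset.sum_sub_distrib]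
    refine Finset.sum_le_sum fun i _ => ?_
    by_cases h : β i = 0
    · simp [restr, supp, h]
    · simp only [restr, supp, h, Finset.mem_filter, Finset.mem_univ, true_and, Finset.mem_compl,
        ne_eq, not_false_eq_true, not_true_eq_false, if_true, if_false, abs_zero, sub_zero,
        Pi.sub_apply]
      have := abs_sub_abs_le_abs_sub (β i) (b i)
      rwa [abs_sub_comm] at this
  have e2 : ∑ g ∈ G, l2 (restr β g) - ∑ g ∈ G, l2 (restr b g) ≤
      ∑ g ∈ gsupp G β, l2 (restr (b - β) g) - ∑ g ∈ G \ gsupp G β, l2 (restr (b - β) g) := by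
    have s : gsupp G β ⊆ G := Finset.filter_subset _ _
    rw [← Finset.sum_sdiff s, ← Finset.sum_sdiff s (f := fun g => l2 (restr b g))]
    have a1 : ∑ g ∈ gsupp G β, l2 (restr β g) ≤ ∑ g ∈ gsupp G β, l2 (restr b g) +
        ∑ g ∈ gsupp G β, l2 (restr (b - β) g) := by
      rw [← Finset.sum_add_distrib]
      refine Finset.sum_le_sum fun g _ => ?_
      have : restr β g = restr b g + restr (β - b) g := by rw [← restr_add]; simp
      have h2 : l2 (restr (β - b) g) = l2 (restr (b - β) g) := by
        unfold l2; congr 1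
        refine Finset.sum_congr rfl fun i _ => ?_
        by_cases h : i ∈ g <;> simp [restr, h]; ring
      rw [this, ← h2]; exact l2_add_le _ _
    have a2 : ∀ g ∈ G \ gsupp G β, restr β g = 0 := by
      intro g hg
      simp only [gsupp, Finset.mem_sdiff, Finset.mem_filter, not_and, not_not] at hg
      exact hg.2 hg.1
    have a3 : ∑ g ∈ G \ gsupp G β, l2 (restr β g) = 0 :=
      Finset.sum_eq_zero fun g hg => by rw [a2 g hg]; simp [l2]
    have a4 : ∑ g ∈ G \ gsupp G β, l2 (restr b g) = ∑ g ∈ G \ gsupp G β, l2 (restr (b - β) g) :=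
      Finset.sum_congr rfl fun g hg => by
        have : restr b g = restr (b - β) g + restr β g := by rw [← restr_add]; simp
        rw [this, a2 g hg, add_zero]
    linarith
  have e3 := mul_le_mul_of_nonneg_left e1 h0
  have e4 := mul_le_mul_of_nonneg_left e2 (sub_nonneg.2 h1)
  unfold sgl sgl0 sgl1; linarith

lemma l1_le_card {p : ℕ} (b : Fin p → ℝ) (S : Finset (Fin p)) :
    l1 (restr b S) ≤ Real.sqrt (S.card) * l2 (restr b S) := by
  have e1 : l1 (restr b S) = ∑ i ∈ S, |b i| := by
    simp [l1, restr, apply_ite abs, Finset.sum_ite_mem]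
  have e2 : l2 (restr b S) = Real.sqrt (∑ i ∈ S, b i ^ 2) := by
    simp [l2, restr, ite_pow, Finset.sum_ite_mem]
  rw [e1, e2, ← Real.sqrt_mul (Nat.cast_nonneg _)]
  apply Real.le_sqrt_of_sq_le
  have := sq_sum_le_card_mul_sum_sq (s := S) (f := fun i => |b i|)
  simpa using this

lemma sup_card_pos {p : ℕ} (hp : 1 ≤ p) (G : Finset (Finset (Fin p))) (hG : IsPartition G) :
    (1 : ℝ) ≤ ((G.sup Finset.card : ℕ) : ℝ) := by
  obtain ⟨g, hg, hi⟩ := hG.2.2 ⟨0, hp⟩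
  have h1 : g.card ≤ G.sup Finset.card := Finset.le_sup (f := Finset.card) hg
  have h2 : 0 < g.card := Finset.card_pos.2 ⟨_, hi⟩
  exact_mod_cast h2.trans_le h1

lemma l1_le_sgl {p : ℕ} (hp : 1 ≤ p) (α : ℝ) (h0 : 0 ≤ α) (h1 : α ≤ 1)
    (G : Finset (Finset (Fin p))) (hG : IsPartition G) (b : Fin p → ℝ) :
    l1 b ≤ Real.sqrt ((G.sup Finset.card : ℕ) : ℝ) * sgl α G b := by
  set K := Real.sqrt ((G.sup Finset.card : ℕ) : ℝ) with hK
  have hK1 : 1 ≤ K := Real.one_le_sqrt.2 (sup_card_pos hp G hG)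
  have e1 : l1 b ≤ K * l1 b := le_mul_of_one_le_left (l1_nonneg b) hK1
  have e2 : l1 b ≤ K * ∑ g ∈ G, l2 (restr b g) := by
    have a1 : l1 b ≤ ∑ g ∈ G, l1 (restr b g) := by
      unfold l1
      rw [Finset.sum_comm]
      refine Finset.sum_le_sum fun i _ => ?_
      obtain ⟨g, hg, hi⟩ := hG.2.2 i
      have := Finset.single_le_sum (f := fun g => |restr b g i|) (fun _ _ => abs_nonneg _) hg
      simpa [restr, hi] using this
    refine a1.trans ?_
    rw [Finset.mul_sum]
    refine Finset.sum_le_sum fun g hg => (l1_le_card b g).trans ?_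
    refine mul_le_mul_of_nonneg_right (Real.sqrt_le_sqrt ?_) (l2_nonneg _)
    exact_mod_cast Finset.le_sup (f := Finset.card) hg
  have e3 := mul_le_mul_of_nonneg_left e1 h0
  have e4 := mul_le_mul_of_nonneg_left e2 (sub_nonneg.2 h1)
  unfold sgl; linarith

lemma sgl0_le {p : ℕ} (α : ℝ) (h0 : 0 ≤ α) (h1 : α ≤ 1)
    (G : Finset (Finset (Fin p))) (hG : IsPartition G) (β b : Fin p → ℝ) :
    sgl0 α G β b ≤ Real.sqrt (salpha α G β) *
      Real.sqrt (∑ g ∈ gsupp G β, l2 (restr b g) ^ 2) := by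
  set E := Real.sqrt (∑ g ∈ gsupp G β, l2 (restr b g) ^ 2) with hE
  have hs : Real.sqrt (salpha α G β) =
      α * Real.sqrt ((supp β).card) + (1 - α) * Real.sqrt ((gsupp G β).card) := by
    unfold salpha
    apply Real.sqrt_sq
    have := sub_nonneg.2 h1
    positivity
  have a1 : l1 (restr b (supp β)) ≤ Real.sqrt ((supp β).card) * E := by
    refine (l1_le_card b _).trans (mul_le_mul_of_nonneg_left ?_ (Real.sqrt_nonneg _))
    apply Real.sqrt_le_sqrt
    have : ∀ g, l2 (restr b g) ^ 2 = ∑ i, restr b g i ^ 2 := fun g =>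
      Real.sq_sqrt (Finset.sum_nonneg fun _ _ => sq_nonneg _)
    simp only [this]
    rw [Finset.sum_comm]
    refine Finset.sum_le_sum fun i _ => ?_
    by_cases hi : β i = 0
    · simp only [restr, supp, hi, Finset.mem_filter, Finset.mem_univ, true_and, ne_eq,
        not_true_eq_false, if_false]
      simpa using Finset.sum_nonneg fun g (_ : g ∈ gsupp G β) => sq_nonneg (if i ∈ g then b i else 0)
    · obtain ⟨g, hg, hig⟩ := hG.2.2 i
      have hg' : g ∈ gsupp G β := by
        simp only [gsupp, Finset.mem_filter]
        refine ⟨hg, fun h => hi ?_⟩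
        have := congrFun h i
        simpa [restr, hig] using this
      have := Finset.single_le_sum (f := fun g => restr b g i ^ 2) (fun _ _ => sq_nonneg _) hg'
      simpa [restr, hig, supp, hi] using this
  have a2 : ∑ g ∈ gsupp G β, l2 (restr b g) ≤ Real.sqrt ((gsupp G β).card) * E := by
    rw [hE, ← Real.sqrt_mul (Nat.cast_nonneg _)]
    apply Real.le_sqrt_of_sq_le
    exact sq_sum_le_card_mul_sum_sq
  have e3 := mul_le_mul_of_nonneg_left a1 h0
  have e4 := mul_le_mul_of_nonneg_left a2 (sub_nonneg.2 h1)
  rw [hs]; unfold sgl0; linarith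

lemma salpha_pos {p : ℕ} (α : ℝ) (h0 : 0 ≤ α) (h1 : α ≤ 1)
    (G : Finset (Finset (Fin p))) (hG : IsPartition G) (β : Fin p → ℝ) (hβ : β ≠ 0) :
    0 < salpha α G β := by
  obtain ⟨i, hi⟩ := Function.ne_iff.1 hβ
  have hi' : β i ≠ 0 := hi
  obtain ⟨g, hg, hig⟩ := hG.2.2 i
  have hg' : g ∈ gsupp G β := by
    simp only [gsupp, Finset.mem_filter]
    refine ⟨hg, fun h => hi' ?_⟩
    have := congrFun h i
    simpa [restr, hig] using this
  have hs : i ∈ supp β := by simp [supp, hi']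
  have c1 : (1 : ℝ) ≤ (supp β).card := by exact_mod_cast Finset.card_pos.2 ⟨_, hs⟩
  have c2 : (1 : ℝ) ≤ (gsupp G β).card := by exact_mod_cast Finset.card_pos.2 ⟨_, hg'⟩
  have d1 := mul_le_mul_of_nonneg_left (Real.one_le_sqrt.2 c1) h0
  have d2 := mul_le_mul_of_nonneg_left (Real.one_le_sqrt.2 c2) (sub_nonneg.2 h1)
  unfold salpha
  apply pow_pos
  linarith

lemma quad_le {p : ℕ} (M : Fin p → Fin p → ℝ) (ε : ℝ) (hM : ∀ j k, |M j k| ≤ ε)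
    (b : Fin p → ℝ) : |∑ j, ∑ k, b j * M j k * b k| ≤ ε * l1 b ^ 2 := by
  have : ε * l1 b ^ 2 = ∑ j, ∑ k, |b j| * ε * |b k| := by
    unfold l1; rw [sq, Finset.sum_mul_sum, Finset.mul_sum]
    refine Finset.sum_congr rfl fun j _ => ?_
    rw [Finset.mul_sum]
    exact Finset.sum_congr rfl fun k _ => by ring
  rw [this]
  refine (Finset.abs_sum_le_sum_abs _ _).trans (Finset.sum_le_sum fun j _ => ?_)
  refine (Finset.abs_sum_le_sum_abs _ _).trans (Finset.sum_le_sum fun k _ => ?_)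
  rw [abs_mul, abs_mul]
  gcongr
  exact hM j k

lemma gram_eq {p T : ℕ} (X : Matrix (Fin T) (Fin p) ℝ) (b : Fin p → ℝ) :
    normT2 (X.mulVec b) = ∑ j, ∑ k, b j * ((∑ t, X t j * X t k) / T) * b k := by
  have h1 : ∀ t, (X.mulVec b t) ^ 2 = ∑ j, ∑ k, b j * (X t j * X t k) * b k := by
    intro t
    simp only [Matrix.mulVec, dotProduct]
    rw [sq, Finset.sum_mul_sum]
    exact Finset.sum_congr rfl fun j _ => Finset.sum_congr rfl fun k _ => by ring
  unfold normT2
  simp only [h1]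
  rw [Finset.sum_comm, Finset.sum_div]
  refine Finset.sum_congr rfl fun j _ => ?_
  rw [Finset.sum_comm, Finset.sum_div]
  refine Finset.sum_congr rfl fun k _ => ?_
  rw [← Finset.sum_mul, ← Finset.mul_sum]; ring

/-- First-order inequality for the minimizer. -/
lemma basic_ineq {p T : ℕ} (α : ℝ) (h0 : 0 ≤ α) (h1 : α ≤ 1)
    (G : Finset (Finset (Fin p))) (X : Matrix (Fin T) (Fin p) ℝ) (y : Fin T → ℝ)
    (lam : ℝ) (hlam : 0 < lam) (β βhat : Fin p → ℝ)
    (hmin : ∀ b : Fin p → ℝ,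
      normT2 (y - X.mulVec βhat) + 2 * lam * sgl α G βhat ≤
        normT2 (y - X.mulVec b) + 2 * lam * sgl α G b) :
    normT2 (X.mulVec (βhat - β)) + lam * (sgl α G βhat - sgl α G β) ≤
      (∑ t, (y - X.mulVec β) t * X.mulVec (βhat - β) t) / T := by
  set z := X.mulVec (βhat - β) with hz
  set D := normT2 z with hD
  set N := (∑ t, (y - X.mulVec β) t * z t) / T with hN
  have hDn : 0 ≤ D := div_nonneg (Finset.sum_nonneg fun _ _ => sq_nonneg _) (Nat.cast_nonneg _)
  have hexp : ∀ s : ℝ, normT2 (y - X.mulVec β - s • z) =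
      normT2 (y - X.mulVec β) - 2 * s * N + s ^ 2 * D := by
    intro s
    simp only [hD, hN, normT2]
    rw [mul_div_assoc', mul_div_assoc', ← sub_div, ← add_div, Finset.mul_sum, Finset.mul_sum,
      ← Finset.sum_sub_distrib, ← Finset.sum_add_distrib]
    congr 1
    refine Finset.sum_congr rfl fun t _ => ?_
    simp only [Pi.sub_apply, Pi.smul_apply, smul_eq_mul]; ring
  have key : ∀ t : ℝ, 0 < t → t ≤ 1 →
      2 * (D + lam * (sgl α G βhat - sgl α G β) - N) ≤ t * D := by
    intro t ht ht1
    have hm := hmin ((1 - t) • βhat + t • β)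
    have hs : sgl α G ((1 - t) • βhat + t • β) ≤ (1 - t) * sgl α G βhat + t * sgl α G β := by
      refine (sgl_add_le α h0 h1 G _ _).trans ?_
      rw [sgl_smul α G _ (by linarith), sgl_smul α G _ ht.le]
    have v1 : y - X.mulVec βhat = y - X.mulVec β - (1 : ℝ) • z := by
      rw [hz, Matrix.mulVec_sub, one_smul]; abel
    have v2 : y - X.mulVec ((1 - t) • βhat + t • β) = y - X.mulVec β - (1 - t) • z := by
      rw [hz, Matrix.mulVec_sub, Matrix.mulVec_add, Matrix.mulVec_smul, Matrix.mulVec_smul]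
      ext i
      simp only [Pi.sub_apply, Pi.add_apply, Pi.smul_apply, smul_eq_mul]; ring
    rw [v1, v2, hexp, hexp] at hm
    have hs' := mul_le_mul_of_nonneg_left hs (by positivity : 0 ≤ 2 * lam)
    refine le_of_mul_le_mul_left ?_ ht
    nlinarith
  by_contra hcon
  push Not at hcon
  set δ := D + lam * (sgl α G βhat - sgl α G β) - N with hδ
  have hδp : 0 < δ := by linarith
  have k := key (min 1 (δ / (D + 1))) (by positivity) (min_le_left _ _)
  have k2 : min 1 (δ / (D + 1)) * D ≤ δ / (D + 1) * D :=
    mul_le_mul_of_nonneg_right (min_le_right _ _) hDn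
  have k3 : δ / (D + 1) * D ≤ δ := by
    rw [div_mul_eq_mul_div, div_le_iff₀ (by positivity)]; nlinarith
  linarith

lemma cs_T {T : ℕ} (a b : Fin T → ℝ) :
    (∑ t, a t * b t) / T ≤ Real.sqrt (normT2 a) * Real.sqrt (normT2 b) := by
  have hn : ∀ v : Fin T → ℝ, 0 ≤ normT2 v := fun v =>
    div_nonneg (Finset.sum_nonneg fun _ _ => sq_nonneg _) (Nat.cast_nonneg _)
  rw [← Real.sqrt_mul (hn a)]
  apply Real.le_sqrt_of_sq_le
  unfold normT2
  rw [div_pow, div_mul_div_comm, ← sq]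
  gcongr
  exact Finset.sum_mul_sq_le_sq_mul_sq _ _ _

set_option maxHeartbeats 2000000 in
/-- deterministic ℓ1 estimation bound for the sg-LASSO
(Remark 1, deterministic form):
`|β̂ − β|₁ ≤ √G* · [ √(2(1+2c₀)²(C₁s_αλ² + 4‖m−Xβ‖_T²)s_α/γ)
  + (1 + 1/(2c₀))·(4c/((c−1)λ))·‖m−Xβ‖_T² ]`,
with `C₁ = 4A(1+c₀)²(1+1/c)²/γ` and `A = 2(1+2c₀)²/(2(1+2c₀)² − (1+c₀)²)`. -/
theorem sgLasso_l1_estimation_bound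
    (p T : ℕ) (hp : 1 ≤ p) (hT : 1 ≤ T)
    (α : ℝ) (hα0 : 0 ≤ α) (hα1 : α ≤ 1)
    (G : Finset (Finset (Fin p))) (hG : IsPartition G)
    (X : Matrix (Fin T) (Fin p) ℝ) (m u : Fin T → ℝ)
    (lam c c0 : ℝ) (hlam : 0 < lam) (hc : 1 < c) (hc0 : c0 = (c + 1) / (c - 1))
    (β : Fin p → ℝ) (hβ : β ≠ 0) (βhat : Fin p → ℝ)
    (hmin : ∀ b : Fin p → ℝ,
      normT2 (m + u - X.mulVec βhat) + 2 * lam * sgl α G βhat ≤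
        normT2 (m + u - X.mulVec b) + 2 * lam * sgl α G b)
    (hdual : ∀ b : Fin p → ℝ,
      |∑ t, u t * X.mulVec b t| / T ≤ (lam / c) * sgl α G b)
    (Sig : Matrix (Fin p) (Fin p) ℝ) (hsym : ∀ j k, Sig j k = Sig k j)
    (γ : ℝ) (hγ : 0 < γ)
    (hRE : ∀ Δ : Fin p → ℝ, sgl1 α G β Δ ≤ (2 * c0) * sgl0 α G β Δ →
      γ * ∑ g ∈ gsupp G β, (l2 (restr Δ g)) ^ 2 ≤ ∑ j, ∑ k, Δ j * Sig j k * Δ k)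
    (hconc : ∀ j k, |(∑ t, X t j * X t k) / T - Sig j k| ≤
      γ / (2 * ((G.sup Finset.card : ℕ) : ℝ) * salpha α G β * (1 + 2 * c0) ^ 2))
    (A C1 : ℝ)
    (hA : A = 2 * (1 + 2 * c0) ^ 2 / (2 * (1 + 2 * c0) ^ 2 - (1 + c0) ^ 2))
    (hC1 : C1 = 4 * A * (1 + c0) ^ 2 * (1 + 1 / c) ^ 2 / γ) :
    l1 (βhat - β) ≤
      Real.sqrt ((G.sup Finset.card : ℕ) : ℝ) *
        (Real.sqrt (2 * (1 + 2 * c0) ^ 2 *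
            (C1 * salpha α G β * lam ^ 2 + 4 * normT (m - X.mulVec β) ^ 2) *
              salpha α G β / γ) +
          (1 + 1 / (2 * c0)) * (4 * c / ((c - 1) * lam)) *
            normT (m - X.mulVec β) ^ 2) := by
  set Δ := βhat - β with hΔ
  set D := normT2 (X.mulVec Δ) with hD
  set s := salpha α G β with hs
  set K : ℝ := ((G.sup Finset.card : ℕ) : ℝ) with hK
  set O0 := sgl0 α G β Δ with hO0
  set O1 := sgl1 α G β Δ with hO1
  have hsp : 0 < s := salpha_pos α hα0 hα1 G hG β hβ
  have hK1 : 1 ≤ K := sup_card_pos hp G hG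
  have hc1 : 0 < c - 1 := by linarith
  have hc0' : c0 * (c - 1) = c + 1 := by rw [hc0]; field_simp
  have hc0p : 1 < c0 := by rw [hc0, lt_div_iff₀ hc1]; linarith
  have hDn : 0 ≤ D := div_nonneg (Finset.sum_nonneg fun _ _ => sq_nonneg _) (Nat.cast_nonneg _)
  set R := normT2 (m - X.mulVec β) with hR
  have hRn : 0 ≤ R := div_nonneg (Finset.sum_nonneg fun _ _ => sq_nonneg _) (Nat.cast_nonneg _)
  have hRe : normT (m - X.mulVec β) ^ 2 = R := Real.sq_sqrt hRn
  rw [hRe]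
  have hα' : 0 ≤ 1 - α := by linarith
  have hO0n : 0 ≤ O0 := add_nonneg (mul_nonneg hα0 (l1_nonneg _))
    (mul_nonneg hα' (Finset.sum_nonneg fun _ _ => l2_nonneg _))
  have hO1n : 0 ≤ O1 := add_nonneg (mul_nonneg hα0 (l1_nonneg _))
    (mul_nonneg hα' (Finset.sum_nonneg fun _ _ => l2_nonneg _))
  have hsplit : sgl α G Δ = O0 + O1 := sgl_split α G β Δ
  have hl1 : l1 Δ ≤ Real.sqrt K * (O0 + O1) := by
    rw [← hsplit]; exact l1_le_sgl hp α hα0 hα1 G hG Δ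
  -- basic inequality
  have hb := basic_ineq α hα0 hα1 G X (m + u) lam hlam β βhat hmin
  have hsum : (∑ t, (m + u - X.mulVec β) t * X.mulVec (βhat - β) t) / T =
      (∑ t, (m - X.mulVec β) t * X.mulVec Δ t) / T + (∑ t, u t * X.mulVec Δ t) / T := by
    rw [← add_div, ← Finset.sum_add_distrib]
    congr 1
    refine Finset.sum_congr rfl fun t _ => ?_
    simp only [Pi.sub_apply, Pi.add_apply, hΔ]; ring
  rw [hsum] at hb
  have hcs := cs_T (m - X.mulVec β) (X.mulVec Δ)
  have hdu : (∑ t, u t * X.mulVec Δ t) / T ≤ lam / c * (O0 + O1) := by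
    rw [← hsplit]
    refine le_trans ?_ (hdual Δ)
    gcongr
    exact le_abs_self _
  have hdf := mul_le_mul_of_nonneg_left (sgl_diff α hα0 hα1 G β βhat) hlam.le
  rw [← hΔ, ← hO0, ← hO1] at hdf
  rw [← hR, ← hD] at hcs
  rw [← hΔ, ← hD] at hb
  set d := Real.sqrt D with hd
  set r := Real.sqrt R with hr
  have hdn : 0 ≤ d := Real.sqrt_nonneg _
  have hrn : 0 ≤ r := Real.sqrt_nonneg _
  have hd2 : d ^ 2 = D := Real.sq_sqrt hDn
  have hr2 : r ^ 2 = R := Real.sq_sqrt hRn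
  have main : D + lam * (1 - 1 / c) * O1 ≤ lam * (1 + 1 / c) * O0 + r * d := by
    have : lam / c = lam * (1 / c) := by ring
    rw [this] at hdu
    linarith
  refine hl1.trans (mul_le_mul_of_nonneg_left ?_ (Real.sqrt_nonneg _))
  have hκp : 0 < (1 + 1 / (2 * c0)) * (4 * c / ((c - 1) * lam)) := by positivity
  by_cases hcone : O1 ≤ (2 * c0) * O0
  · refine le_trans ?_ (le_add_of_nonneg_right (mul_nonneg hκp.le hRn))
    have hre := hRE Δ hcone
    set E2 := ∑ g ∈ gsupp G β, (l2 (restr Δ g)) ^ 2 with hE2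
    have hE2n : 0 ≤ E2 := Finset.sum_nonneg fun _ _ => sq_nonneg _
    have hO0le : O0 ≤ Real.sqrt s * Real.sqrt E2 := sgl0_le α hα0 hα1 G hG β Δ
    have hO0sq : O0 ^ 2 ≤ s * E2 := by
      have := pow_le_pow_left₀ hO0n hO0le 2
      rwa [mul_pow, Real.sq_sqrt hsp.le, Real.sq_sqrt hE2n] at this
    have htot : O0 + O1 ≤ (1 + 2 * c0) * O0 := by linarith
    have htotsq : (O0 + O1) ^ 2 ≤ (1 + 2 * c0) ^ 2 * (s * E2) := by
      have := pow_le_pow_left₀ (by positivity) htot 2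
      rw [mul_pow] at this
      exact this.trans (mul_le_mul_of_nonneg_left hO0sq (by positivity))
    have hl1sq : l1 Δ ^ 2 ≤ K * ((1 + 2 * c0) ^ 2 * (s * E2)) := by
      have := pow_le_pow_left₀ (l1_nonneg Δ) hl1 2
      rw [mul_pow, Real.sq_sqrt (by linarith)] at this
      exact this.trans (mul_le_mul_of_nonneg_left htotsq (by linarith))
    have hq := quad_le (fun j k => (∑ t, X t j * X t k) / T - Sig j k) _ hconc Δ
    have hqe : ∑ j, ∑ k, Δ j * ((∑ t, X t j * X t k) / T - Sig j k) * Δ k =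
        D - ∑ j, ∑ k, Δ j * Sig j k * Δ k := by
      rw [hD, gram_eq, ← Finset.sum_sub_distrib]
      refine Finset.sum_congr rfl fun j _ => ?_
      rw [← Finset.sum_sub_distrib]
      exact Finset.sum_congr rfl fun k _ => by ring
    rw [hqe] at hq
    have hq1 := (abs_le.1 hq).1
    have hq2 : γ / (2 * K * s * (1 + 2 * c0) ^ 2) * l1 Δ ^ 2 ≤ γ / 2 * E2 := by
      refine (mul_le_mul_of_nonneg_left hl1sq (by positivity)).trans (le_of_eq ?_)
      have : (1 + 2 * c0) ≠ 0 := by positivity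
      have : K ≠ 0 := by positivity
      field_simp
    have hγE : γ * E2 ≤ 2 * D := by linarith
    have hE : E2 ≤ 2 * D / γ := by rw [le_div_iff₀ hγ]; linarith
    -- bound on D
    set L := lam * (1 + 1 / c) with hL
    have hLp : 0 < L := by positivity
    have hDd : d ^ 2 ≤ L * O0 + r * d := by
      have : 0 ≤ lam * (1 - 1 / c) * O1 := by
        have : 1 / c ≤ 1 := by rw [div_le_one (by linarith)]; exact hc.le
        have : 0 ≤ 1 - 1 / c := by linarith
        positivity
      rw [hd2]; linarith
    have hO0d : O0 ≤ Real.sqrt (2 * s / γ) * d := by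
      refine abs_le_of_sq_le_sq' ?_ (by positivity) |>.2
      rw [mul_pow, Real.sq_sqrt (by positivity), hd2]
      refine hO0sq.trans ((mul_le_mul_of_nonneg_left hE hsp.le).trans (le_of_eq ?_))
      ring
    have hdle : d ≤ L * Real.sqrt (2 * s / γ) + r := by
      rcases hdn.eq_or_lt with h | h
      · rw [← h]; positivity
      · refine le_of_mul_le_mul_right ?_ h
        have := mul_le_mul_of_nonneg_left hO0d hLp.le
        have e : d * d = d ^ 2 := by ring
        rw [e, add_mul]
        linarith
    have hDle : D ≤ 4 * L ^ 2 * s / γ + 2 * R := by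
      have h1 := pow_le_pow_left₀ hdn hdle 2
      have h2 : (L * Real.sqrt (2 * s / γ)) ^ 2 = 2 * L ^ 2 * s / γ := by
        rw [mul_pow, Real.sq_sqrt (by positivity)]; ring
      have h3 := sq_nonneg (L * Real.sqrt (2 * s / γ) - r)
      have h4 : 4 * L ^ 2 * s / γ = 2 * (2 * L ^ 2 * s / γ) := by ring
      rw [← hd2, ← hr2, h4, ← h2]
      linarith
    have hA1 : 1 ≤ A := by
      have : 0 < 2 * (1 + 2 * c0) ^ 2 - (1 + c0) ^ 2 := by
        have e : (1 + c0) ^ 2 ≤ (1 + 2 * c0) ^ 2 := pow_le_pow_left₀ (by linarith) (by linarith) 2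
        have e' : 0 < (1 + 2 * c0) ^ 2 := by positivity
        linarith
      rw [hA, le_div_iff₀ this]
      have e := sq_nonneg (1 + c0)
      linarith
    have hA2 : 1 ≤ A * (1 + c0) ^ 2 :=
      one_le_mul_of_one_le_of_one_le hA1 (one_le_pow₀ (by linarith))
    have hC : 4 * L ^ 2 * s / γ ≤ C1 * s * lam ^ 2 := by
      have : C1 * s * lam ^ 2 = (A * (1 + c0) ^ 2) * (4 * L ^ 2 * s / γ) := by
        rw [hC1, hL]; ring
      rw [this]
      exact le_mul_of_one_le_left (by positivity) hA2
    apply Real.le_sqrt_of_sq_le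
    have hfin : D ≤ C1 * s * lam ^ 2 + 4 * R := by linarith
    calc (O0 + O1) ^ 2 ≤ (1 + 2 * c0) ^ 2 * (s * E2) := htotsq
      _ ≤ (1 + 2 * c0) ^ 2 * (s * (2 * D / γ)) := by gcongr
      _ = 2 * (1 + 2 * c0) ^ 2 * D * s / γ := by ring
      _ ≤ _ := by gcongr
  · push Not at hcone
    refine le_trans ?_ (le_add_of_nonneg_left (Real.sqrt_nonneg _))
    have hO0lt : O0 ≤ 1 / (2 * c0) * O1 := by
      rw [one_div_mul_eq_div, le_div_iff₀ (by positivity)]; linarith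
    have htot : O0 + O1 ≤ (1 + 1 / (2 * c0)) * O1 := by linarith
    refine htot.trans ?_
    rw [mul_assoc]
    refine mul_le_mul_of_nonneg_left ?_ (by positivity)
    rw [div_mul_eq_mul_div, le_div_iff₀ (by positivity)]
    have m2 : c * D + lam * (c - 1) * O1 ≤ lam * (c + 1) * O0 + c * (r * d) := by
      have hcp : 0 < c := by linarith
      have := mul_le_mul_of_nonneg_left main hcp.le
      have e1 : c * (D + lam * (1 - 1 / c) * O1) = c * D + lam * (c - 1) * O1 := by
        field_simp
      have e2 : c * (lam * (1 + 1 / c) * O0 + r * d) = lam * (c + 1) * O0 + c * (r * d) := by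
        field_simp
      linarith
    have m3 : lam * (c + 1) * O0 ≤ lam * (c - 1) * O1 / 2 := by
      rw [← hc0']
      have := mul_le_mul_of_nonneg_left hcone.le (by positivity : 0 ≤ lam * (c - 1))
      linarith
    have m4 : c * (r * d) - c * D ≤ c * R := by
      rw [← mul_sub]
      refine mul_le_mul_of_nonneg_left ?_ (by linarith)
      rw [← hd2, ← hr2]
      have e := sq_nonneg (r - d)
      have e1 := sq_nonneg r
      have e2 := sq_nonneg d
      have e3 : (r - d) ^ 2 = r ^ 2 - 2 * (r * d) + d ^ 2 := by ring
      linarith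
    have : 0 ≤ c * R := mul_nonneg (by linarith) hRn
    linarith
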